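/- Let R and S be Noetherian local rings such that for every n ≥ 1 the Artinian local rings R/m_R^n and S/m_S^n are similar. Then R and S are similar. -/

import Mathlib

open IsLocalRing

universe u v

/-- A local homomorphism `f : R → S` between local rings is a *scalar extension* if `S` is
faithfully flat as an `R`-module (via `f`) and `f` is unramified, i.e. the maximal ideal of `S`
is the extension of the maximal ideal of `R`. -/
def IsScalarExtension {R S : Type*} [CommRing R] [CommRing S] [IsLocalRing R] [IsLocalRing S]
    (f : R →+* S) : Prop :=
  (letI : Algebra R S := f.toAlgebra; Module.FaithfullyFlat R S) ∧
    (maximalIdeal R).map f = maximalIdeal S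

/-- Two local rings are *similar* if they admit a common scalar extension which is a Noetherian
local ring. -/
def AreSimilar (R : Type u) (S : Type v) [CommRing R] [CommRing S]
    [IsLocalRing R] [IsLocalRing S] : Prop :=
  ∃ (T : Type (max u v)) (_ : CommRing T) (_ : IsNoetherianRing T) (_ : IsLocalRing T)
    (f : R →+* T) (g : S →+* T) (_ : IsLocalHom f) (_ : IsLocalHom g),
    IsScalarExtension f ∧ IsScalarExtension g

theorem Ideal.exists_fg_le_map_eq {A B : Type*} [CommRing A] [CommRing B] {f : A →+* B}
    (hf : Function.Surjective f) {p : Ideal A} (hp : (p.map f).FG) :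
    ∃ q ≤ p, q.FG ∧ q.map f = p.map f := by
  classical
  obtain ⟨s, hs⟩ := hp
  have hsub : (s : Set B) ⊆ f '' p := fun b hb =>
    (Ideal.mem_map_iff_of_surjective f hf).mp (hs ▸ Ideal.subset_span hb)
  obtain ⟨t, htp, rfl⟩ := Finset.subset_set_image_iff.mp hsub
  refine ⟨Ideal.span t, Ideal.span_le.mpr htp, ⟨t, rfl⟩, ?_⟩
  rw [Ideal.map_span, ← Finset.coe_image]
  exact hs

/-- The finitely generated ideals of `A` are closed in the `m`-adic topology. -/
def HasClosedFGIdeals {A : Type*} [CommRing A] (m : Ideal A) : Prop :=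
  ∀ I : Ideal A, I.FG → ∀ x : A, (∀ k : ℕ, x ∈ I ⊔ m ^ k) → x ∈ I

theorem HasClosedFGIdeals.map_mk {A : Type*} [CommRing A] {m : Ideal A}
    (hm : HasClosedFGIdeals m) (a : A) :
    HasClosedFGIdeals (m.map (Ideal.Quotient.mk (Ideal.span {a}))) := by
  intro I hI x hx
  obtain ⟨x, rfl⟩ := Ideal.Quotient.mk_surjective x
  have hsurj : Function.Surjective (Ideal.Quotient.mk (Ideal.span {a})) :=
    Ideal.Quotient.mk_surjective
  rw [← Ideal.map_comap_of_surjective _ hsurj I] at hI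
  obtain ⟨q, -, hq, hqI⟩ := Ideal.exists_fg_le_map_eq hsurj hI
  rw [Ideal.map_comap_of_surjective _ hsurj] at hqI
  have hmem : ∀ J : Ideal A, Ideal.Quotient.mk (Ideal.span {a}) x ∈
      J.map (Ideal.Quotient.mk (Ideal.span {a})) ↔ x ∈ J ⊔ Ideal.span {a} := fun J => by
    rw [← Ideal.mem_comap, Ideal.comap_map_of_surjective _ hsurj, ← RingHom.ker, Ideal.mk_ker]
  rw [← hqI, hmem]
  refine hm _ (Submodule.FG.sup hq ⟨{a}, by simp⟩) x fun k => ?_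
  have h := hx k
  rwa [← hqI, ← Ideal.map_pow, ← Ideal.map_sup, hmem, sup_right_comm] at h

theorem HasClosedFGIdeals.isNoetherianRing_of_quotient {A : Type*} [CommRing A] {m : Ideal A}
    (hm : HasClosedFGIdeals m) {a : A} (ha : a ∈ m)
    [IsNoetherianRing (A ⧸ Ideal.span {a})] : IsNoetherianRing A := by
  refine IsNoetherianRing.of_prime fun p hp => ?_
  obtain ⟨q, hqp, hq, hmap⟩ := Ideal.exists_fg_le_map_eq
    (Ideal.Quotient.mk_surjective (I := Ideal.span {a})) (p := p) (IsNoetherian.noetherian _)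
  have hsup : q ⊔ Ideal.span {a} = p ⊔ Ideal.span {a} := by
    have h := congrArg (Ideal.comap (Ideal.Quotient.mk (Ideal.span {a}))) hmap
    rwa [Ideal.comap_map_of_surjective _ Ideal.Quotient.mk_surjective,
      Ideal.comap_map_of_surjective _ Ideal.Quotient.mk_surjective, ← RingHom.ker,
      Ideal.mk_ker] at h
  by_cases hap : a ∈ p
  · rw [← sup_eq_left.mpr ((Ideal.span_singleton_le_iff_mem p).mpr hap), ← hsup]
    exact Submodule.FG.sup hq ⟨{a}, by simp⟩
  · have hstep : p ≤ q ⊔ Ideal.span {a} * p := by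
      intro x hx
      have hx' : x ∈ q ⊔ Ideal.span {a} := hsup ▸ Ideal.mem_sup_left hx
      obtain ⟨y, hy, z, hz, rfl⟩ := Submodule.mem_sup.mp hx'
      obtain ⟨c, rfl⟩ := Ideal.mem_span_singleton.mp hz
      have hc : a * c ∈ p := (Ideal.add_mem_iff_right p (hqp hy)).mp hx
      exact Submodule.add_mem_sup hy
        (Ideal.mul_mem_mul (Ideal.mem_span_singleton_self a) ((hp.mem_or_mem hc).resolve_left hap))
    have hle : ∀ k : ℕ, p ≤ q ⊔ Ideal.span {a} ^ k := by
      intro k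
      induction k with
      | zero => simp
      | succ k ih =>
        refine hstep.trans (sup_le le_sup_left ((Ideal.mul_mono_right ih).trans ?_))
        rw [Ideal.mul_sup, ← pow_succ']
        exact sup_le_sup_right Ideal.mul_le_right _
    rwa [← le_antisymm hqp (fun x hx => hm q hq x fun k =>
      sup_le_sup_left (Ideal.pow_right_mono ((Ideal.span_singleton_le_iff_mem _).mpr ha) k) _
        (hle k hx))]

theorem HasClosedFGIdeals.isNoetherianRing_ofList {A : Type u} [CommRing A] (l : List A)
    (hmax : (Ideal.ofList l).IsMaximal) (hm : HasClosedFGIdeals (Ideal.ofList l)) :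
    IsNoetherianRing A := by
  induction hl : l.length generalizing A with
  | zero =>
    obtain rfl := List.length_eq_zero_iff.mp hl
    rw [Ideal.ofList_nil] at hmax
    have : Nontrivial A := (Submodule.nontrivial_iff A).mp ⟨⊥, ⊤, hmax.ne_top⟩
    let := (Ring.isField_iff_maximal_bot.mpr hmax).toField
    infer_instance
  | succ n ih =>
    obtain ⟨a, l, rfl⟩ := List.exists_cons_of_length_eq_add_one hl
    set π := Ideal.Quotient.mk (Ideal.span {a})
    have hmap : (Ideal.ofList (a :: l)).map π = Ideal.ofList (l.map π) := by
      rw [Ideal.ofList_cons, Ideal.map_sup, Ideal.map_quotient_self, bot_sup_eq, Ideal.map_ofList]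
    have hle : Ideal.span {a} ≤ Ideal.ofList (a :: l) := by
      rw [Ideal.ofList_cons]; exact le_sup_left
    have : IsNoetherianRing (A ⧸ Ideal.span {a}) := by
      refine ih (l.map π) ?_ (hmap ▸ hm.map_mk a) (by simpa using hl)
      rw [← hmap]
      refine (Ideal.map_eq_top_or_isMaximal_of_surjective π Ideal.Quotient.mk_surjective
        hmax).resolve_left fun htop => hmax.ne_top ?_
      have h := congrArg (Ideal.comap π) htop
      rwa [Ideal.comap_map_of_surjective _ Ideal.Quotient.mk_surjective, ← RingHom.ker,
        Ideal.mk_ker, sup_eq_left.mpr hle, Ideal.comap_top] at h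
    exact hm.isNoetherianRing_of_quotient (hle (Ideal.mem_span_singleton_self a))

theorem HasClosedFGIdeals.isNoetherianRing {A : Type*} [CommRing A] {m : Ideal A}
    [m.IsMaximal] (hfg : m.FG) (hm : HasClosedFGIdeals m) : IsNoetherianRing A := by
  obtain ⟨s, rfl⟩ := hfg
  have h : Ideal.span (s : Set A) = Ideal.ofList s.toList := by simp [Ideal.ofList]
  exact HasClosedFGIdeals.isNoetherianRing_ofList s.toList (h ▸ ‹_›) (h ▸ hm)

open Filter in
/-- Countable saturation along a non-principal filter on `ℕ`. -/
theorem exists_forall_eventually_of_antitone {X : ℕ → Type*} [∀ n, Nonempty (X n)]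
    {l : Filter ℕ} (hl : l ≤ atTop) (Q : ∀ n, ℕ → X n → Prop)
    (hQ : ∀ n k k' t, k ≤ k' → Q n k' t → Q n k t)
    (h : ∀ k, ∀ᶠ n in l, ∃ t, Q n k t) :
    ∃ t : ∀ n, X n, ∀ k, ∀ᶠ n in l, Q n k (t n) := by
  classical
  have key : ∀ n, ∃ t : X n, ∀ k ≤ n, (∃ t', Q n k t') → Q n k t := by
    intro n
    by_cases h0 : ∃ t, Q n 0 t
    · obtain ⟨t, ht⟩ := Nat.findGreatest_spec (P := fun k => ∃ t, Q n k t) (Nat.zero_le n) h0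
      exact ⟨t, fun k hk hk' => hQ n _ _ t (Nat.le_findGreatest hk hk') ht⟩
    · exact ⟨Classical.arbitrary _, fun k _ ⟨t', ht'⟩ => absurd ⟨t', hQ n 0 k t' k.zero_le ht'⟩ h0⟩
  choose t ht using key
  refine ⟨t, fun k => ?_⟩
  filter_upwards [h k, hl (eventually_ge_atTop k)] with n h1 h2
  exact ht n k h2 h1

/-- Every relation with coefficients in `R` holding in the `R`-algebra `A` is, modulo the
ideal `I` of `R`, trivial. -/
def RelationsTrivialModulo {R A : Type*} [CommRing R] [CommRing A] (f : R →+* A)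
    (I : Ideal R) : Prop :=
  ∀ (ι : Type) [Fintype ι] (r : ι → R) (x : ι → A), ∑ i, f (r i) * x i = 0 →
    ∃ (k : ℕ) (a : ι → Fin k → R) (y : Fin k → A),
      (∀ i, x i = ∑ j, f (a i j) * y j) ∧ ∀ j, ∑ i, r i * a i j ∈ I

theorem relationsTrivialModulo_comp_mk {R A : Type*} [CommRing R] [CommRing A] {I : Ideal R}
    (g : R ⧸ I →+* A) (hg : letI := g.toAlgebra; Module.Flat (R ⧸ I) A) :
    RelationsTrivialModulo (g.comp (Ideal.Quotient.mk I)) I := by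
  intro ι _ r x h
  let := g.toAlgebra
  have : Module.Flat (R ⧸ I) A := hg
  obtain ⟨k, a, y, hx, ha⟩ := Module.Flat.isTrivialRelation_of_sum_smul_eq_zero
    (f := fun i => Ideal.Quotient.mk I (r i)) (x := x) h
  choose a' ha' using fun i j => Ideal.Quotient.mk_surjective (a i j)
  refine ⟨k, a', y, fun i => ?_, fun j => ?_⟩
  · rw [hx i]
    simp only [RingHom.comp_apply, ha']
    rfl
  · rw [← Ideal.Quotient.eq_zero_iff_mem, map_sum, ← ha j]
    simp only [map_mul, ha']

/-- A form of the Artin-Rees lemma: vectors that almost satisfy a linear equation are close to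
solutions of it. -/
theorem Ideal.exists_approx_of_sum_mem_pow {R ι : Type*} [CommRing R] [IsNoetherianRing R]
    [Fintype ι] (I : Ideal R) (r : ι → R) :
    ∃ c₀ : ℕ, ∀ (k : ℕ) (c : ι → R), ∑ i, c i * r i ∈ I ^ (k + c₀) →
      ∃ e : ι → R, (∀ i, e i ∈ I ^ k) ∧ ∑ i, (c i - e i) * r i = 0 := by
  obtain ⟨c₀, hc₀⟩ := I.exists_pow_inf_eq_pow_smul (Submodule.span R (Set.range r))
  refine ⟨c₀, fun k c hc => ?_⟩
  have hmem : ∑ i, c i * r i ∈ I ^ k • Submodule.span R (Set.range r) := by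
    have h := hc₀ (k + c₀) (Nat.le_add_left _ _)
    rw [Nat.add_sub_cancel] at h
    refine Submodule.smul_mono le_rfl inf_le_right (h.le ⟨?_, ?_⟩)
    · simpa using hc
    · exact (Submodule.mem_span_range_iff_exists_fun R).mpr ⟨c, rfl⟩
  obtain ⟨e, he, hsum⟩ := (Submodule.mem_ideal_smul_span_iff_exists_sum _ _ _).mp hmem
  refine ⟨e, he, ?_⟩
  rw [Finsupp.sum_fintype _ _ (by simp)] at hsum
  simp only [sub_mul, Finset.sum_sub_distrib, ← hsum, smul_eq_mul, sub_self]

section Cataproduct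

open Filter

universe w

variable (T : ℕ → Type w) [∀ n, CommRing (T n)] [∀ n, IsLocalRing (T n)]

/-- The sequences lying in the `k`-th power of the maximal ideal eventually along `l`. -/
def eventuallyPowIdeal (l : Filter ℕ) (k : ℕ) : Ideal (∀ n, T n) where
  carrier := {x | ∀ᶠ n in l, x n ∈ maximalIdeal (T n) ^ k}
  add_mem' hx hy := by
    filter_upwards [hx, hy] with n h₁ h₂ using Ideal.add_mem _ h₁ h₂
  zero_mem' := Eventually.of_forall fun n => Ideal.zero_mem _
  smul_mem' c x hx := by
    filter_upwards [hx] with n h using Ideal.mul_mem_left _ _ h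

/-- The sequences which along `l` are eventually in every power of the maximal ideal. -/
def infinitesimalIdeal (l : Filter ℕ) : Ideal (∀ n, T n) := ⨅ k, eventuallyPowIdeal T l k

/-- The cataproduct of a sequence of local rings along `l`: for an ultrafilter `l`, this is the
ultraproduct modulo its infinitesimals. -/
abbrev Cataproduct (l : Filter ℕ) : Type w := (∀ n, T n) ⧸ infinitesimalIdeal T l

namespace Cataproduct

variable {T} {l : Filter ℕ}

/-- The class of a sequence in the cataproduct. -/
abbrev mk (l : Filter ℕ) : (∀ n, T n) →+* Cataproduct T l :=
  Ideal.Quotient.mk (infinitesimalIdeal T l)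

theorem mem_eventuallyPowIdeal {k : ℕ} {x : ∀ n, T n} :
    x ∈ eventuallyPowIdeal T l k ↔ ∀ᶠ n in l, x n ∈ maximalIdeal (T n) ^ k := Iff.rfl

theorem infinitesimalIdeal_le (k : ℕ) : infinitesimalIdeal T l ≤ eventuallyPowIdeal T l k :=
  iInf_le _ k

theorem mem_infinitesimalIdeal {x : ∀ n, T n} :
    x ∈ infinitesimalIdeal T l ↔ ∀ k, ∀ᶠ n in l, x n ∈ maximalIdeal (T n) ^ k := by
  simp only [infinitesimalIdeal, Ideal.mem_iInf, mem_eventuallyPowIdeal]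

theorem mk_eq_mk_iff {x y : ∀ n, T n} :
    mk l x = mk l y ↔ ∀ k, ∀ᶠ n in l, x n - y n ∈ maximalIdeal (T n) ^ k := by
  rw [Ideal.Quotient.eq, mem_infinitesimalIdeal]; rfl

theorem isUnit_mk_iff {x : ∀ n, T n} : IsUnit (mk l x) ↔ ∀ᶠ n in l, IsUnit (x n) := by
  constructor
  · intro h
    obtain ⟨y, hy⟩ := h.exists_right_inv
    obtain ⟨y, rfl⟩ := Ideal.Quotient.mk_surjective y
    rw [← map_mul, ← map_one (mk l), mk_eq_mk_iff] at hy
    filter_upwards [hy 1] with n hn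
    rw [pow_one] at hn
    by_contra hu
    have h1 : (1 : T n) ∈ maximalIdeal (T n) := by
      simpa using Ideal.sub_mem _
        (Ideal.mul_mem_right (y n) _ ((mem_maximalIdeal (x n)).mpr hu)) hn
    exact (Ideal.ne_top_iff_one _).mp (maximalIdeal.isMaximal (T n)).ne_top h1
  · intro h
    refine IsUnit.of_mul_eq_one (mk l fun n => Ring.inverse (x n)) ?_
    rw [← map_mul, ← map_one (mk l), mk_eq_mk_iff]
    intro k
    filter_upwards [h] with n hn
    simp [Ring.mul_inverse_cancel _ hn]

instance isLocalRing (l : Ultrafilter ℕ) : IsLocalRing (Cataproduct T (l : Filter ℕ)) := by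
  have : Nontrivial (Cataproduct T (l : Filter ℕ)) := by
    refine ⟨0, 1, fun h => ?_⟩
    have h0 : IsUnit (mk (l : Filter ℕ) (0 : ∀ n, T n)) := by
      rw [map_zero, h]; exact isUnit_one
    obtain ⟨n, hn⟩ := (isUnit_mk_iff.mp h0).exists
    exact not_isUnit_zero hn
  refine IsLocalRing.of_isUnit_or_isUnit_one_sub_self fun x => ?_
  obtain ⟨x, rfl⟩ := Ideal.Quotient.mk_surjective x
  rw [← map_one (mk (l : Filter ℕ)), ← map_sub, isUnit_mk_iff, isUnit_mk_iff,
    ← Ultrafilter.eventually_or]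
  exact Eventually.of_forall fun n => isUnit_or_isUnit_one_sub_self (x n)

theorem mk_mem_maximalIdeal_iff {l : Ultrafilter ℕ} {x : ∀ n, T n} :
    mk (l : Filter ℕ) x ∈ maximalIdeal (Cataproduct T (l : Filter ℕ)) ↔
      ∀ᶠ n in (l : Filter ℕ), x n ∈ maximalIdeal (T n) := by
  simp only [mem_maximalIdeal, mem_nonunits_iff, isUnit_mk_iff, Ultrafilter.eventually_not]

theorem eventually_mem_of_mk_mem_maximalIdeal_pow {l : Ultrafilter ℕ} {x : ∀ n, T n} {k : ℕ}
    (hx : mk (l : Filter ℕ) x ∈ maximalIdeal (Cataproduct T (l : Filter ℕ)) ^ k) :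
    ∀ᶠ n in (l : Filter ℕ), x n ∈ maximalIdeal (T n) ^ k := by
  have hmax : maximalIdeal (Cataproduct T (l : Filter ℕ)) =
      (eventuallyPowIdeal T l 1).map (mk (l : Filter ℕ)) := by
    ext y
    obtain ⟨y, rfl⟩ := Ideal.Quotient.mk_surjective y
    rw [mk_mem_maximalIdeal_iff, Ideal.mem_quotient_iff_mem (infinitesimalIdeal_le 1),
      mem_eventuallyPowIdeal]
    simp only [pow_one]
  have hpow : eventuallyPowIdeal T l 1 ^ k ≤ eventuallyPowIdeal T l k := by
    clear hx
    induction k with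
    | zero => intro x _; exact Eventually.of_forall fun n => by simp
    | succ k ih =>
      rw [pow_succ, Ideal.mul_le]
      intro r hr s hs
      filter_upwards [mem_eventuallyPowIdeal.mp (ih hr), mem_eventuallyPowIdeal.mp hs]
        with n hrn hsn
      rw [pow_one] at hsn
      exact Ideal.mul_mem_mul hrn hsn
  rw [hmax, ← Ideal.map_pow] at hx
  exact (Ideal.mem_quotient_iff_mem (infinitesimalIdeal_le k)).mp (Ideal.map_mono hpow hx)

theorem exists_mk_eq_sum {ι κ : Type*} [Fintype κ] [Finite ι] (hl : l ≤ atTop)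
    (x : ι → ∀ n, T n) (z : κ → ι → ∀ n, T n)
    (h : ∀ k, ∀ᶠ n in l, ∃ t : κ → T n, ∀ i, x i n - ∑ j, t j * z j i n ∈ maximalIdeal (T n) ^ k) :
    ∃ t : κ → Cataproduct T l, ∀ i, mk l (x i) = ∑ j, t j * mk l (z j i) := by
  obtain ⟨t, ht⟩ := exists_forall_eventually_of_antitone hl
    (fun n k (t : κ → T n) => ∀ i, x i n - ∑ j, t j * z j i n ∈ maximalIdeal (T n) ^ k)
    (fun n k k' t hk h i => Ideal.pow_le_pow_right hk (h i)) h
  refine ⟨fun j => mk l fun n => t n j, fun i => ?_⟩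
  simp only [← map_mul, ← map_sum, mk_eq_mk_iff]
  intro k
  filter_upwards [ht k] with n hn
  simpa [Finset.sum_apply] using hn i

theorem hasClosedFGIdeals {l : Ultrafilter ℕ} (hl : (l : Filter ℕ) ≤ atTop) :
    HasClosedFGIdeals (maximalIdeal (Cataproduct T (l : Filter ℕ))) := by
  intro I hI x hx
  obtain ⟨q, z, rfl⟩ := Submodule.fg_iff_exists_fin_generating_family.mp hI
  obtain ⟨x, rfl⟩ := Ideal.Quotient.mk_surjective x
  choose z' hz' using fun j => Ideal.Quotient.mk_surjective (z j)
  obtain ⟨t, ht⟩ := exists_mk_eq_sum (ι := Unit) hl (fun _ => x) (fun j _ => z' j) (by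
    intro k
    obtain ⟨y, hy, v, hv, hyv⟩ := Submodule.mem_sup.mp (hx k)
    obtain ⟨c, rfl⟩ := (Submodule.mem_span_range_iff_exists_fun _).mp hy
    choose c' hc' using fun j => Ideal.Quotient.mk_surjective (c j)
    have : mk (l : Filter ℕ) (x - ∑ j, c' j * z' j) ∈
        maximalIdeal (Cataproduct T (l : Filter ℕ)) ^ k := by
      rw [map_sub, map_sum, ← hyv]
      simpa [hc', hz'] using hv
    filter_upwards [eventually_mem_of_mk_mem_maximalIdeal_pow this] with n hn
    exact ⟨fun j => c' j n, fun _ => by simpa [Finset.sum_apply] using hn⟩)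
  rw [ht ()]
  exact Submodule.sum_mem _ fun j _ => Ideal.mul_mem_left _ _
    (Submodule.subset_span ⟨j, (hz' j).symm⟩)

section Map

variable {R : Type u} [CommRing R] [IsLocalRing R] [IsNoetherianRing R] (f : ∀ n, R →+* T n)

/-- The homomorphism to the cataproduct induced by a sequence of homomorphisms. -/
def map (l : Filter ℕ) : R →+* Cataproduct T l := (mk l).comp (RingHom.pi f)

variable {f}

theorem map_maximalIdeal {l : Ultrafilter ℕ}
    (hf : ∀ n, (maximalIdeal R).map (f n) = maximalIdeal (T n)) :
    (maximalIdeal R).map (map f (l : Filter ℕ)) = maximalIdeal (Cataproduct T (l : Filter ℕ)) := by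
  apply le_antisymm
  · rw [Ideal.map_le_iff_le_comap]
    intro r hr
    exact mk_mem_maximalIdeal_iff.mpr (Eventually.of_forall fun n =>
      hf n ▸ Ideal.mem_map_of_mem (f n) hr)
  · intro x hx
    obtain ⟨x, rfl⟩ := Ideal.Quotient.mk_surjective x
    obtain ⟨q, b, hb⟩ := Submodule.fg_iff_exists_fin_generating_family.mp
      (IsNoetherian.noetherian (maximalIdeal R))
    have key : ∀ n, ∃ t : Fin q → T n, x n ∈ maximalIdeal (T n) → x n = ∑ j, t j * f n (b j) := by
      intro n
      by_cases hn : x n ∈ maximalIdeal (T n)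
      · rw [← hf n, ← hb, ← Ideal.span, Ideal.map_span, ← Set.range_comp] at hn
        obtain ⟨t, ht⟩ := (Submodule.mem_span_range_iff_exists_fun _).mp hn
        exact ⟨t, fun _ => ht.symm⟩
      · exact ⟨0, fun h => absurd h hn⟩
    choose t ht using key
    have hx' : mk (l : Filter ℕ) x =
        ∑ j, mk (l : Filter ℕ) (fun n => t n j) * map f (l : Filter ℕ) (b j) := by
      simp only [map, RingHom.comp_apply, ← map_mul, ← map_sum, mk_eq_mk_iff]
      intro k
      filter_upwards [mk_mem_maximalIdeal_iff.mp hx] with n hn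
      have h0 : x n - ∑ j, t n j * f n (b j) = 0 := sub_eq_zero.mpr (ht n hn)
      simp only [Finset.sum_apply, Pi.mul_apply, RingHom.pi_apply, h0, zero_mem]
    rw [hx']
    exact Submodule.sum_mem _ fun j _ => Ideal.mul_mem_left _ _
      (Ideal.mem_map_of_mem _ (hb ▸ Submodule.subset_span ⟨j, rfl⟩))

theorem isNoetherianRing {l : Ultrafilter ℕ} (hl : (l : Filter ℕ) ≤ atTop)
    (hf : ∀ n, (maximalIdeal R).map (f n) = maximalIdeal (T n)) :
    IsNoetherianRing (Cataproduct T (l : Filter ℕ)) := by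
  refine (hasClosedFGIdeals hl).isNoetherianRing ?_
  rw [← map_maximalIdeal hf]
  exact Ideal.FG.map (IsNoetherian.noetherian _) _

/-- If the relations holding in the `n`-th ring are trivial modulo the `n`-th power of the maximal
ideal of `R`, then the cataproduct is flat over `R`. -/
theorem flat {l : Ultrafilter ℕ} (hl : (l : Filter ℕ) ≤ atTop)
    (hf : ∀ n, (maximalIdeal R).map (f n) = maximalIdeal (T n))
    (hrel : ∀ n, RelationsTrivialModulo (f n) (maximalIdeal R ^ n)) :
    letI := (map f (l : Filter ℕ)).toAlgebra; Module.Flat R (Cataproduct T (l : Filter ℕ)) := by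
  let := (map f (l : Filter ℕ)).toAlgebra
  refine Module.Flat.of_forall_isTrivialRelation fun {s r x} hx => ?_
  choose x' hx' using fun i => Ideal.Quotient.mk_surjective (x i)
  obtain rfl : (fun i => mk (l : Filter ℕ) (x' i)) = x := funext hx'
  have hsum : ∀ k, ∀ᶠ n in (l : Filter ℕ), ∑ i, f n (r i) * x' i n ∈ maximalIdeal (T n) ^ k := by
    have hmem : ∑ i, RingHom.pi f (r i) * x' i ∈ infinitesimalIdeal T l := by
      rw [← Ideal.Quotient.eq_zero_iff_mem, map_sum, ← hx]
      simp only [map_mul]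
      rfl
    simpa only [Finset.sum_apply, Pi.mul_apply, RingHom.pi_apply] using
      mem_infinitesimalIdeal.mp hmem
  obtain ⟨c₀, hc₀⟩ := (maximalIdeal R).exists_approx_of_sum_mem_pow r
  obtain ⟨q, z, hz⟩ := Submodule.fg_iff_exists_fin_generating_family.mp
    (IsNoetherian.noetherian (LinearMap.ker (Fintype.linearCombination R r)))
  have hz0 : ∀ j, ∑ i, z j i * r i = 0 := fun j => by
    have h : z j ∈ LinearMap.ker (Fintype.linearCombination R r) :=
      hz ▸ Submodule.subset_span ⟨j, rfl⟩
    simpa [Fintype.linearCombination_apply] using h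
  obtain ⟨t, ht⟩ := exists_mk_eq_sum hl x' (fun j i => RingHom.pi f (z j i)) (by
    intro k
    obtain ⟨p, b, hb⟩ := Submodule.fg_iff_exists_fin_generating_family.mp
      (IsNoetherian.noetherian (maximalIdeal R ^ (k + c₀)))
    filter_upwards [hsum (k + c₀), hl (eventually_ge_atTop (k + c₀))] with n hn hkn
    rw [← hf n, ← Ideal.map_pow, ← hb, ← Ideal.span, Ideal.map_span, ← Set.range_comp] at hn
    obtain ⟨u, hu⟩ := (Submodule.mem_span_range_iff_exists_fun _).mp hn
    obtain ⟨K, a, y, hxa, ha⟩ := hrel n _ (Sum.elim r b) (Sum.elim (fun i => x' i n) (-u)) (by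
      rw [Fintype.sum_sum_type]
      simp only [Sum.elim_inl, Sum.elim_inr, ← hu, Pi.neg_apply, Function.comp_apply, smul_eq_mul,
        mul_neg, Finset.sum_neg_distrib, mul_comm (u _), add_neg_cancel])
    have ha' : ∀ j, ∑ i, a (Sum.inl i) j * r i ∈ maximalIdeal R ^ (k + c₀) := fun j => by
      have h := Ideal.pow_le_pow_right hkn (ha j)
      rw [Fintype.sum_sum_type] at h
      simp only [Sum.elim_inl, Sum.elim_inr] at h
      rw [Ideal.add_mem_iff_left] at h
      · simpa only [mul_comm] using h
      · exact Ideal.sum_mem _ fun i _ => Ideal.mul_mem_right _ _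
          (hb ▸ Submodule.subset_span ⟨i, rfl⟩)
    choose e he hae using fun j => hc₀ k _ (ha' j)
    have hg : ∀ j, ∃ g : Fin q → R, ∑ m, g m • z m = fun i => a (Sum.inl i) j - e j i := fun j => by
      rw [← Submodule.mem_span_range_iff_exists_fun, hz]
      simpa [Fintype.linearCombination_apply] using hae j
    choose g hg using hg
    refine ⟨fun m => ∑ j, f n (g j m) * y j, fun i => ?_⟩
    have hi : x' i n - ∑ m, (∑ j, f n (g j m) * y j) * f n (z m i) =
        ∑ j, f n (e j i) * y j := by
      have h1 : ∀ j, f n (a (Sum.inl i) j) =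
          (∑ m, f n (g j m) * f n (z m i)) + f n (e j i) := fun j => by
        have h2 := congrFun (hg j) i
        simp only [Finset.sum_apply, Pi.smul_apply, smul_eq_mul] at h2
        rw [← sub_eq_iff_eq_add, ← map_sub, ← h2]
        simp
      have h3 := hxa (Sum.inl i)
      simp only [Sum.elim_inl, h1, add_mul, Finset.sum_add_distrib, Finset.sum_mul] at h3
      rw [h3, Finset.sum_comm]
      simp only [Finset.sum_mul, mul_right_comm, add_sub_cancel_left]
    refine hi ▸ Ideal.sum_mem _ fun j _ => Ideal.mul_mem_right _ _ ?_
    rw [← hf n, ← Ideal.map_pow]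
    exact Ideal.mem_map_of_mem _ (he j i))
  refine ⟨q, fun i j => z j i, t, fun i => ?_, fun j => ?_⟩
  · refine (ht i).trans ?_
    exact Finset.sum_congr rfl fun j _ => mul_comm _ _
  · simpa only [mul_comm] using hz0 j

theorem isScalarExtension_map {l : Ultrafilter ℕ} (hl : (l : Filter ℕ) ≤ atTop)
    (hf : ∀ n, (maximalIdeal R).map (f n) = maximalIdeal (T n))
    (hrel : ∀ n, RelationsTrivialModulo (f n) (maximalIdeal R ^ n)) :
    IsLocalHom (map f (l : Filter ℕ)) ∧ IsScalarExtension (map f (l : Filter ℕ)) := by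
  have hloc : IsLocalHom (map f (l : Filter ℕ)) :=
    ((local_hom_TFAE _).out 0 2).mpr (map_maximalIdeal hf).le
  refine ⟨hloc, ?_, map_maximalIdeal hf⟩
  let := (map f (l : Filter ℕ)).toAlgebra
  have : Module.Flat R (Cataproduct T (l : Filter ℕ)) := flat hl hf hrel
  have : IsLocalHom (algebraMap R (Cataproduct T (l : Filter ℕ))) := hloc
  exact Module.FaithfullyFlat.of_flat_of_isLocalHom

end Map

end Cataproduct

end Cataproduct

/-- The maximal ideal of a scalar extension of `R ⧸ I` is extended from `R`, and its relations
over `R` are trivial modulo `I`. -/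
theorem IsScalarExtension.comp_mk {R A : Type*} [CommRing R] [CommRing A] [IsLocalRing R]
    [IsLocalRing A] {I : Ideal R} [IsLocalRing (R ⧸ I)] {g : R ⧸ I →+* A}
    (hg : IsScalarExtension g) :
    (maximalIdeal R).map (g.comp (Ideal.Quotient.mk I)) = maximalIdeal A ∧
      RelationsTrivialModulo (g.comp (Ideal.Quotient.mk I)) I := by
  obtain ⟨hflat, hmax⟩ := hg
  let := g.toAlgebra
  refine ⟨?_, relationsTrivialModulo_comp_mk g hflat.toFlat⟩
  rw [← Ideal.map_map,
    IsLocalRing.map_maximalIdeal_of_surjective _ Ideal.Quotient.mk_surjective, hmax]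

theorem RelationsTrivialModulo.mono {R A : Type*} [CommRing R] [CommRing A] {f : R →+* A}
    {I J : Ideal R} (h : RelationsTrivialModulo f I) (hIJ : I ≤ J) :
    RelationsTrivialModulo f J := fun ι _ r x hx =>
  let ⟨k, a, y, hy, ha⟩ := h ι r x hx
  ⟨k, a, y, hy, fun j => hIJ (ha j)⟩

theorem isLocalRing_quotient_maximalIdeal_pow (R : Type*) [CommRing R] [IsLocalRing R] (n : ℕ) :
    IsLocalRing (R ⧸ maximalIdeal R ^ (n + 1)) := by
  have : Nontrivial (R ⧸ maximalIdeal R ^ (n + 1)) := Ideal.Quotient.nontrivial_iff.mpr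
    (ne_top_of_le_ne_top (maximalIdeal.isMaximal R).ne_top (Ideal.pow_le_self n.succ_ne_zero))
  exact .of_surjective' _ Ideal.Quotient.mk_surjective

/-- if for every `n ≥ 1` the Artinian local rings `R/m_R^n` and `S/m_S^n` are
similar, then `R` and `S` are similar. -/
theorem areSimilar_of_jets_areSimilar
    {R : Type u} {S : Type v} [CommRing R] [CommRing S]
    [IsNoetherianRing R] [IsNoetherianRing S] [IsLocalRing R] [IsLocalRing S]
    (h : ∀ n : ℕ, 1 ≤ n →
      ∀ (_ : IsLocalRing (R ⧸ maximalIdeal R ^ n)) (_ : IsLocalRing (S ⧸ maximalIdeal S ^ n)),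
        AreSimilar (R ⧸ maximalIdeal R ^ n) (S ⧸ maximalIdeal S ^ n)) :
    AreSimilar R S := by
  have hR := isLocalRing_quotient_maximalIdeal_pow R
  have hS := isLocalRing_quotient_maximalIdeal_pow S
  choose T _ _ _ f g _ _ hf hg using fun n => h (n + 1) n.succ_pos (hR n) (hS n)
  have hl := Nat.hyperfilter_le_atTop
  have hfmax := fun n => (hf n).comp_mk.1
  obtain ⟨hfloc, hfext⟩ := Cataproduct.isScalarExtension_map hl hfmax fun n =>
    (hf n).comp_mk.2.mono (Ideal.pow_le_pow_right n.le_succ)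
  obtain ⟨hgloc, hgext⟩ := Cataproduct.isScalarExtension_map hl (fun n => (hg n).comp_mk.1) fun n =>
    (hg n).comp_mk.2.mono (Ideal.pow_le_pow_right n.le_succ)
  exact ⟨_, _, Cataproduct.isNoetherianRing hl hfmax, _, _, _, hfloc, hgloc, hfext, hgext⟩
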